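/- arXiv:1105.3947 — 2 statements merged into one kernel-verified Lean document; each statement's English description precedes it below -/
import Mathlib

section
/- Let Y, P : [0,∞) → [0,∞) with Y continuously differentiable and P continuous. Assume ∫₀^∞ Y(t) dt < ∞, ∫₀^∞ P(t) dt < ∞, and that there are constants C₁, C₂ ≥ 0 such that Y'(t) ≤ C₁·Y(t) + C₂·√(P(t)·Y(t)) for all t ≥ 0. Then Y(t) → 0 as t → ∞. -/
open MeasureTheory Filter Set

/-- A nonnegative function on `[0,∞)` whose derivative is bounded above by an integrable function
has a limit at infinity. -/
theorem exists_tendsto_atTop_of_hasDerivWithinAt_le {f f' g : ℝ → ℝ}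
    (hf : ∀ t ∈ Ici (0:ℝ), 0 ≤ f t)
    (hderiv : ∀ t ∈ Ici (0:ℝ), HasDerivWithinAt f (f' t) (Ici 0) t)
    (hg : IntegrableOn g (Ici 0)) (hle : ∀ t ∈ Ici (0:ℝ), f' t ≤ g t) :
    ∃ L, Tendsto f atTop (nhds L) := by
  have hgi : ∀ a b : ℝ, 0 ≤ a → 0 ≤ b → IntervalIntegrable g volume a b := fun a b ha hb =>
    (hg.mono_set fun x hx => (le_min ha hb).trans hx.1).intervalIntegrable
  set G : ℝ → ℝ := fun t => ∫ x in (0:ℝ)..t, g x with hG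
  set H : ℝ → ℝ := fun t => f (max t 0) - G (max t 0) with hH
  have hanti : Antitone H := by
    intro s t hst
    have hs : (0:ℝ) ≤ max s 0 := le_max_right _ _
    have ht : (0:ℝ) ≤ max t 0 := le_max_right _ _
    have hst' : max s 0 ≤ max t 0 := max_le_max_right 0 hst
    have hfg : f (max t 0) - f (max s 0) ≤ ∫ x in (max s 0)..(max t 0), g x :=
      intervalIntegral.sub_le_integral_of_hasDeriv_right_of_le hst'
        (fun x hx => (hderiv x (hs.trans hx.1)).continuousWithinAt.mono
          fun y hy => hs.trans hy.1)
        (fun x hx => (hderiv x (hs.trans hx.1.le)).mono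
          fun y hy => (hs.trans hx.1.le).trans (le_of_lt hy))
        (hg.mono_set fun y hy => hs.trans hy.1)
        (fun x hx => hle x (hs.trans hx.1.le))
    have hadd := intervalIntegral.integral_add_adjacent_intervals
      (hgi 0 (max s 0) le_rfl hs) (hgi (max s 0) (max t 0) hs ht)
    simp only [hH, hG]
    linarith
  have hGlim : Tendsto G atTop (nhds (∫ x in Ioi (0:ℝ), g x)) :=
    intervalIntegral_tendsto_integral_Ioi 0 (hg.mono_set Ioi_subset_Ici_self) tendsto_id
  have heq : (fun t => H t + G t) =ᶠ[atTop] f := by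
    filter_upwards [eventually_ge_atTop 0] with t ht
    simp [hH, max_eq_left ht]
  rcases tendsto_atTop_of_antitone hanti with hbot | ⟨l, hl⟩
  · have hfbot : Tendsto f atTop atBot := (hbot.atBot_add hGlim).congr' heq
    obtain ⟨t, ht, ht0⟩ := ((hfbot.eventually_lt_atBot 0).and (eventually_ge_atTop 0)).exists
    exact absurd (hf t ht0) ht.not_ge
  · exact ⟨_, (hl.add hGlim).congr' heq⟩

/-- If `Y, P : [0,∞) → [0,∞)`, `Y` is continuously differentiable,
`P` is continuous, `∫₀^∞ Y < ∞`, `∫₀^∞ P < ∞`, and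
`Y' ≤ C₁·Y + C₂·√(P·Y)` on `[0,∞)` for some constants `C₁, C₂ ≥ 0`,
then `Y(t) → 0` as `t → ∞`. -/
theorem gradient_norm_decay
    (Y P Y' : ℝ → ℝ)
    (hYnn : ∀ t ∈ Ici (0:ℝ), 0 ≤ Y t)
    (hPnn : ∀ t ∈ Ici (0:ℝ), 0 ≤ P t)
    (hderiv : ∀ t ∈ Ici (0:ℝ), HasDerivWithinAt Y (Y' t) (Ici 0) t)
    (hY'cont : ContinuousOn Y' (Ici 0))
    (hPcont : ContinuousOn P (Ici 0))
    (hYint : IntegrableOn Y (Ici 0))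
    (hPint : IntegrableOn P (Ici 0))
    (C₁ C₂ : ℝ) (hC₁ : 0 ≤ C₁) (hC₂ : 0 ≤ C₂)
    (hineq : ∀ t ∈ Ici (0:ℝ), Y' t ≤ C₁ * Y t + C₂ * Real.sqrt (P t * Y t)) :
    Tendsto Y atTop (nhds 0) := by
  obtain ⟨L, hL⟩ : ∃ L, Tendsto Y atTop (nhds L) := by
    refine exists_tendsto_atTop_of_hasDerivWithinAt_le hYnn hderiv
      ((hYint.const_mul C₁).add ((hPint.add hYint).const_mul C₂)) fun t ht => (hineq t ht).trans ?_
    have hY := hYnn t ht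
    have hP := hPnn t ht
    have hsqrt : Real.sqrt (P t * Y t) ≤ P t + Y t :=
      Real.sqrt_le_iff.2 ⟨add_nonneg hP hY, by nlinarith [mul_nonneg hP hY]⟩
    exact add_le_add_right (mul_le_mul_of_nonneg_left hsqrt hC₂) _
  have hL0 : L = 0 := by
    refine IntegrableAtFilter.eq_zero_of_tendsto (μ := volume)
      ⟨Ici 0, Ici_mem_atTop 0, hYint⟩ (fun s hs => ?_) hL
    obtain ⟨b, hb⟩ := mem_atTop_sets.1 hs
    rw [← top_le_iff, ← Real.volume_Ici (a := b)]
    exact measure_mono hb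
  rwa [hL0] at hL
end

section
/- Let λ > 0, N ∈ ℕ, let a₁, …, a_N > 0, and let δ₁, …, δ_N ≥ 0 with Σ_{j=1}^N δ_j = 1. Let K₀ ≥ max_j a_j and let Y : [0,∞) → [0,∞) be a bounded continuously differentiable function satisfying Y'(t) ≤ −λ·Y(t) + (λ/2)·Y(t)^{1/2}·Π_{j=1}^N Y(t − a_j)^{δ_j/2} for all t ≥ K₀. Then there exist constants C > 0 and ε > 0 such that Y(t) ≤ C·e^{−ε t} for all t ≥ 0. -/
open Set Filter

/-- A first-crossing principle for functions on a half-line: if `g` is nonpositive on `[0, K]` and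
has negative derivative at any zero `s ≥ K` such that `g ≤ 0` on `[0, s]`, then `g ≤ 0`. -/
theorem nonpos_of_deriv_neg_at_first_zero {g g' : ℝ → ℝ} {K : ℝ} (hK : 0 ≤ K)
    (hg : ∀ t ∈ Ici (0 : ℝ), HasDerivWithinAt g (g' t) (Ici 0) t)
    (hinit : ∀ t ∈ Icc 0 K, g t ≤ 0)
    (hcross : ∀ s ≥ K, g s = 0 → (∀ t ∈ Icc 0 s, g t ≤ 0) → g' s < 0) :
    ∀ t ≥ 0, g t ≤ 0 := by
  by_contra! h
  obtain ⟨t₀, ht₀, hgt₀⟩ := h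
  set S : Set ℝ := {t | 0 ≤ t ∧ 0 < g t} with hS
  have hSK : ∀ t ∈ S, K ≤ t := fun t ht => by
    by_contra! hlt
    exact (hinit t ⟨ht.1, hlt.le⟩).not_gt ht.2
  have hne : S.Nonempty := ⟨t₀, ht₀, hgt₀⟩
  have hbdd : BddBelow S := ⟨K, hSK⟩
  set s := sInf S with hs
  have hKs : K ≤ s := le_csInf hne hSK
  have hs0 : 0 ≤ s := hK.trans hKs
  have hbefore : ∀ t, 0 ≤ t → t < s → g t ≤ 0 := fun t ht hts => by
    by_contra! hlt
    exact (csInf_le hbdd ⟨ht, hlt⟩).not_gt hts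
  have hcont : ContinuousWithinAt g (Ici 0) s := (hg s hs0).continuousWithinAt
  have hgs : g s ≤ 0 := by
    rcases hKs.eq_or_lt with hEq | hlt
    · exact hinit s ⟨hs0, hEq.ge⟩
    · have hs_pos : 0 < s := hK.trans_lt hlt
      have hleft : Tendsto g (nhdsWithin s (Ioo 0 s)) (nhds (g s)) :=
        hcont.mono fun x hx => hx.1.le
      rw [nhdsWithin_Ioo_eq_nhdsLT hs_pos] at hleft
      refine le_of_tendsto hleft ?_
      filter_upwards [Ioo_mem_nhdsLT hs_pos] with x hx
      exact hbefore x hx.1.le hx.2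
  have hupto : ∀ t ∈ Icc 0 s, g t ≤ 0 := fun t ht => by
    rcases ht.2.eq_or_lt with hEq | hlt
    · rwa [hEq]
    · exact hbefore t ht.1 hlt
  have hIoi : Ioi s ⊆ Ici 0 := fun x hx => hs0.trans (le_of_lt hx)
  have hright : ∀ᶠ x in nhdsWithin s (Ioi s), g x ≤ 0 := by
    rcases hgs.lt_or_eq with hneg | hzero
    · exact ((hcont.mono hIoi).eventually_lt_const hneg).mono fun x hx => hx.le
    · have hslope := (hasDerivWithinAt_iff_tendsto_slope' self_notMem_Ioi).1
        ((hg s hs0).mono hIoi)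
      filter_upwards [hslope.eventually_lt_const (hcross s hKs hzero hupto),
        self_mem_nhdsWithin] with x hx hsx
      rw [slope_def_field, hzero, sub_zero, div_lt_iff₀ (sub_pos.2 hsx), zero_mul] at hx
      exact hx.le
  obtain ⟨u, hu, hsub⟩ := mem_nhdsGT_iff_exists_Ioo_subset.1 hright
  obtain ⟨x, hxS, hxu⟩ := exists_lt_of_csInf_lt hne hu
  rcases (csInf_le hbdd hxS).eq_or_lt with hEq | hlt
  · exact hgs.not_gt (by rw [hs, hEq]; exact hxS.2)
  · exact (hsub ⟨hlt, hxu⟩ : g x ≤ 0).not_gt hxS.2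

/-- For weights of total mass one, the product of the powers `y j ^ (δ j / 2)` is at most `√P`
whenever `0 ≤ y j ≤ P` for all `j`. -/
theorem prod_rpow_half_le_sqrt {ι : Type*} [Fintype ι] {y δ : ι → ℝ} {P : ℝ} (hP : 0 < P)
    (hδ : ∀ j, 0 ≤ δ j) (hsum : ∑ j, δ j = 1) (hy : ∀ j, 0 ≤ y j) (hyP : ∀ j, y j ≤ P) :
    ∏ j, y j ^ (δ j / 2) ≤ Real.sqrt P :=
  calc ∏ j, y j ^ (δ j / 2) ≤ ∏ j, P ^ (δ j / 2) :=
        Finset.prod_le_prod (fun j _ => Real.rpow_nonneg (hy j) _) fun j _ =>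
          Real.rpow_le_rpow (hy j) (hyP j) (div_nonneg (hδ j) zero_le_two)
    _ = Real.sqrt P := by
        rw [← Real.rpow_sum_of_pos hP, ← Finset.sum_div, hsum, Real.sqrt_eq_rpow]

/-- Delayed differential inequality lemma (Phong–Song–Sturm–Weinkove).
If `λ > 0`, `a₁, …, a_N > 0`, `δ₁, …, δ_N ≥ 0` with `Σ δ_j = 1`, `K₀ ≥ max_j a_j`,
and `Y : [0,∞) → [0,∞)` is a bounded continuously differentiable function with
`Y'(t) ≤ −λ·Y(t) + (λ/2)·Y(t)^{1/2}·Π_j Y(t − a_j)^{δ_j/2}` for all `t ≥ K₀`,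
then `Y(t) ≤ C·e^{−εt}` on `[0,∞)` for some constants `C, ε > 0`. -/
theorem delayed_ode_exp_decay
    (lam : ℝ) (hlam : 0 < lam) (N : ℕ)
    (a δ : Fin N → ℝ) (ha : ∀ j, 0 < a j) (hδ : ∀ j, 0 ≤ δ j)
    (hsum : ∑ j, δ j = 1)
    (K₀ : ℝ) (hK₀ : ∀ j, a j ≤ K₀)
    (Y Y' : ℝ → ℝ)
    (hYnn : ∀ t ∈ Ici (0:ℝ), 0 ≤ Y t)
    (hbdd : ∃ M : ℝ, ∀ t ∈ Ici (0:ℝ), Y t ≤ M)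
    (hderiv : ∀ t ∈ Ici (0:ℝ), HasDerivWithinAt Y (Y' t) (Ici 0) t)
    (hY'cont : ContinuousOn Y' (Ici 0))
    (hineq : ∀ t ≥ K₀, Y' t ≤ -lam * Y t +
      (lam / 2) * Real.sqrt (Y t) * ∏ j, (Y (t - a j)) ^ (δ j / 2)) :
    ∃ C > (0:ℝ), ∃ ε > (0:ℝ), ∀ t ≥ (0:ℝ), Y t ≤ C * Real.exp (-ε * t) := by
  obtain ⟨M, hM⟩ := hbdd
  have hK : 0 < K₀ := by
    have hN : Nonempty (Fin N) := by
      by_contra hempty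
      rw [not_nonempty_iff] at hempty
      simp at hsum
    exact hN.elim fun j => (ha j).trans_le (hK₀ j)
  have hM0 : 0 ≤ M := (hYnn 0 self_mem_Ici).trans (hM 0 self_mem_Ici)
  obtain ⟨ε, hε, hεlam, hεK⟩ : ∃ ε > 0, ε < lam / 4 ∧ ε * K₀ ≤ 1 / 2 := by
    refine ⟨min (lam / 8) (1 / (2 * K₀)), by positivity, ?_, ?_⟩
    · exact (min_le_left _ _).trans_lt (by linarith)
    · calc min (lam / 8) (1 / (2 * K₀)) * K₀ ≤ 1 / (2 * K₀) * K₀ := by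
            gcongr
            exact min_le_right _ _
        _ = 1 / 2 := by field_simp
  have hexp : Real.exp (ε * K₀) ≤ 2 := by
    have h₁ := Real.one_sub_le_exp_neg (ε * K₀)
    have h₂ : Real.exp (ε * K₀) * Real.exp (-(ε * K₀)) = 1 := by
      rw [← Real.exp_add, add_neg_cancel, Real.exp_zero]
    nlinarith [Real.exp_pos (ε * K₀)]
  set C := (M + 1) * Real.exp (ε * K₀) with hC
  have hCpos : 0 < C := by positivity
  refine ⟨C, hCpos, ε, hε, fun t ht => sub_nonpos.1 ?_⟩
  refine nonpos_of_deriv_neg_at_first_zero (g := fun t => Y t - C * Real.exp (-ε * t))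
    (g' := fun t => Y' t - C * (Real.exp (-ε * t) * (-ε * 1))) hK.le
    (fun t ht => (hderiv t ht).sub
      ((((hasDerivAt_id t).const_mul (-ε)).exp.const_mul C).hasDerivWithinAt)) ?_ ?_ t ht
  · intro t ht
    have h : M ≤ C * Real.exp (-ε * t) := by
      rw [hC, mul_assoc, ← Real.exp_add]
      have : 1 ≤ Real.exp (ε * K₀ + -ε * t) := Real.one_le_exp (by nlinarith [ht.2])
      nlinarith
    linarith [hM t ht.1]
  · intro s hs hzero hupto
    set B := C * Real.exp (-ε * s) with hB
    have hBpos : 0 < B := by positivity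
    have hYs : Y s = B := sub_eq_zero.1 hzero
    have hprod : ∏ j, Y (s - a j) ^ (δ j / 2) ≤ Real.sqrt (2 * B) := by
      refine prod_rpow_half_le_sqrt (by positivity) hδ hsum
        (fun j => hYnn _ (sub_nonneg.2 ((hK₀ j).trans hs))) fun j => ?_
      have hj := hupto (s - a j) ⟨sub_nonneg.2 ((hK₀ j).trans hs), by linarith [ha j]⟩
      calc Y (s - a j) ≤ C * Real.exp (-ε * (s - a j)) := sub_nonpos.1 hj
        _ ≤ C * Real.exp (ε * K₀ + -ε * s) := by
            gcongr
            nlinarith [hK₀ j]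
        _ = Real.exp (ε * K₀) * B := by rw [hB, Real.exp_add]; ring
        _ ≤ 2 * B := by gcongr
    have hsqrt : Real.sqrt B * Real.sqrt (2 * B) ≤ 3 / 2 * B := by
      rw [← Real.sqrt_mul hBpos.le]
      exact Real.sqrt_le_iff.2 ⟨by positivity, by nlinarith [sq_nonneg B]⟩
    have hmain := hineq s hs
    rw [hYs] at hmain
    have hdelay : lam / 2 * Real.sqrt B * ∏ j, Y (s - a j) ^ (δ j / 2)
        ≤ lam / 2 * (3 / 2 * B) := by
      rw [mul_assoc]
      exact mul_le_mul_of_nonneg_left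
        ((mul_le_mul_of_nonneg_left hprod (Real.sqrt_nonneg B)).trans hsqrt) (by positivity)
    have hBderiv : C * (Real.exp (-ε * s) * (-ε * 1)) = -ε * B := by rw [hB]; ring
    change Y' s - C * (Real.exp (-ε * s) * (-ε * 1)) < 0
    rw [hBderiv]
    nlinarith [mul_lt_mul_of_pos_right hεlam hBpos]
end
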